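/- Let P : ℝ^n → ℝ be a d-homogeneous polynomial and L : (ℝ^n)^d → ℝ its unique associated symmetric d-linear form (so that L(x, …, x) = P(x) for all x). Then for every 1 ≤ k ≤ d and all x, y ∈ [-1,1]^n: |L(x, …, x, y, …, y)| ≤ M_{k,d} · (d^d / (k^k (d−k)^{d−k})) · (k!(d−k)!/d!) · ‖P‖_{[-1,1]^n}, where x appears k times and y appears d−k times. -/

import Mathlib

open Finset

/-- The Markov number `M_{m,d}`: the absolute value of the coefficient of `t^m` in the
Chebyshev polynomial `T_d` if `m ≡ d (mod 2)`, and in `T_{d-1}` if `m ≡ d - 1 (mod 2)`. -/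
noncomputable def markovNum (m d : ℕ) : ℝ :=
  if m % 2 = d % 2 then |(Polynomial.Chebyshev.T ℝ (d : ℤ)).coeff m|
  else |(Polynomial.Chebyshev.T ℝ ((d : ℤ) - 1)).coeff m|

/-- The sup norm of a real polynomial in `n` variables over the cube `[-1,1]^n`. -/
noncomputable def supOnBox {n : ℕ} (P : MvPolynomial (Fin n) ℝ) : ℝ :=
  sSup {y : ℝ | ∃ x : Fin n → ℝ, (∀ i, x i ∈ Set.Icc (-1 : ℝ) 1) ∧
    y = |MvPolynomial.eval x P|}

open Polynomial

theorem coeff_ne_zero_or_of_card_roots {q : ℝ[X]} {N m : ℕ} (hdeg : q.natDegree ≤ N)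
    (hroots : N ≤ q.roots.toFinset.card) (hmN : m + 1 ≤ N) :
    q.coeff m ≠ 0 ∨ q.coeff (m + 1) ≠ 0 := by
  induction m generalizing q N with
  | zero =>
    by_contra! h
    have hq : q ≠ 0 := by
      rintro rfl
      simp at hroots
      omega
    have hnodup : q.roots.Nodup := by
      rw [← Multiset.toFinset_card_eq_card_iff_nodup]
      exact le_antisymm (Multiset.toFinset_card_le _)
        ((q.card_roots'.trans hdeg).trans hroots)
    have h1 : 1 < q.rootMultiplicity 0 := by
      rw [one_lt_rootMultiplicity_iff_isRoot hq]
      simp [IsRoot, ← coeff_zero_eq_eval_zero, coeff_derivative, h.1, h.2]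
    have := Multiset.nodup_iff_count_le_one.1 hnodup 0
    rw [count_roots] at this
    omega
  | succ m ih =>
    have h := ih (q := derivative q) (N := N - 1)
      ((natDegree_derivative_le q).trans (Nat.sub_le_sub_right hdeg 1))
      (by have := card_roots_toFinset_le_derivative q; omega) (by omega)
    simp only [coeff_derivative] at h
    exact h.imp left_ne_zero_of_mul left_ne_zero_of_mul

theorem le_card_roots_of_alternating {q : ℝ[X]} {N : ℕ}
    (h : ∀ i ≤ N, 0 < (-1) ^ i * q.eval (Chebyshev.node N i)) :
    N ≤ q.roots.toFinset.card := by
  have hq : q ≠ 0 := by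
    rintro rfl
    simpa using h 0
  have hex : ∀ i < N, ∃ r ∈ Set.Ioo (Chebyshev.node N (i + 1)) (Chebyshev.node N i),
      q.eval r = 0 := by
    intro i hi
    have hlt : Chebyshev.node N (i + 1) < Chebyshev.node N i := Chebyshev.node_lt hi i.lt_succ_self
    have h1 := h i hi.le
    have h2 := h (i + 1) hi
    have hmem : (0 : ℝ) ∈ Set.Ioo ((-1) ^ i * q.eval (Chebyshev.node N (i + 1)))
        ((-1) ^ i * q.eval (Chebyshev.node N i)) := by
      refine ⟨?_, h1⟩
      rw [pow_succ] at h2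
      linarith
    obtain ⟨r, hr, hr0⟩ := intermediate_value_Ioo hlt.le
      (f := fun t => (-1) ^ i * q.eval t) (by fun_prop) hmem
    exact ⟨r, hr, by simpa using hr0⟩
  choose! r hr hr0 using hex
  have hanti : ∀ i < N, ∀ j < N, i < j → r j < r i := by
    intro i hi j hj hij
    refine (hr j hj).2.trans_le (le_trans ?_ (hr i hi).1.le)
    rcases (Nat.succ_le_of_lt hij).eq_or_lt with h | h
    · rw [← h]
    · exact (Chebyshev.node_lt hj.le h).le
  have hcard := Finset.card_le_card_of_injOn (s := range N) (t := q.roots.toFinset) r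
    (fun i hi => by simpa [hq] using hr0 i (by simpa using hi))
    (fun i hi j hj hij => by
      simp only [coe_range, Set.mem_Iio] at hi hj
      rcases lt_trichotomy i j with h | h | h
      · exact absurd hij (hanti i hi j hj h).ne'
      · exact h
      · exact absurd hij (hanti j hj i hi h).ne)
  simpa using hcard

theorem coeff_comp_neg_X (p : ℝ[X]) (j : ℕ) : (p.comp (-X)).coeff j = (-1) ^ j * p.coeff j := by
  rw [show (-X : ℝ[X]) = C (-1) * X by simp, comp_C_mul_X_coeff, mul_comm]

theorem coeff_T_eq_zero {N j : ℕ} (h : j % 2 ≠ N % 2) :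
    (Chebyshev.T ℝ (N : ℤ)).coeff j = 0 := by
  have hcomp : (Chebyshev.T ℝ (N : ℤ)).comp (-X) = C ((-1) ^ N) * Chebyshev.T ℝ (N : ℤ) := by
    refine Polynomial.funext fun x => ?_
    simp [Chebyshev.T_eval_neg]
  have hc := congrArg (coeff · j) hcomp
  simp only [coeff_comp_neg_X, coeff_C_mul] at hc
  have hpow : (-1 : ℝ) ^ j = -(-1) ^ N := by
    rcases Nat.even_or_odd N with hN | hN
    · rw [hN.neg_one_pow, Odd.neg_one_pow (by grind)]
    · rw [hN.neg_one_pow, Even.neg_one_pow (by grind)]; simp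
  rw [hpow] at hc
  have hne : (-1 : ℝ) ^ N ≠ 0 := by simp
  exact (mul_eq_zero.1 (by linarith : (-1 : ℝ) ^ N * _ = 0)).resolve_left hne

theorem abs_coeff_le_of_parity {p : ℝ[X]} {N m : ℕ} {M : ℝ} (hdeg : p.natDegree ≤ N)
    (hpar : ∀ j, j % 2 ≠ N % 2 → p.coeff j = 0)
    (hM : ∀ t ∈ Set.Icc (-1 : ℝ) 1, |p.eval t| ≤ M)
    (hm : m ≠ 0) (hmN : m ≤ N) (hmpar : m % 2 = N % 2) :
    |p.coeff m| ≤ |(Chebyshev.T ℝ (N : ℤ)).coeff m| * M := by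
  by_contra! hlt
  have hM0 : 0 ≤ M := (abs_nonneg _).trans (hM 0 (by simp))
  have ha : 0 < |p.coeff m| := lt_of_le_of_lt (by positivity) hlt
  set c := (Chebyshev.T ℝ (N : ℤ)).coeff m / p.coeff m with hc
  have hcM : |c| * M < 1 := by
    rw [hc, abs_div, div_mul_eq_mul_div, div_lt_one ha]
    exact hlt
  obtain ⟨m, rfl⟩ := Nat.exists_eq_succ_of_ne_zero hm
  have halt : ∀ i ≤ N, 0 < (-1) ^ i *
      (Chebyshev.T ℝ (N : ℤ) - C c * p).eval (Chebyshev.node N i) := by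
    intro i hi
    rw [eval_sub, Chebyshev.eval_T_real_node (by simpa using hi), mul_sub, ← mul_pow]
    simp only [mul_neg, mul_one, neg_neg, one_pow, eval_mul, eval_C, sub_pos]
    refine (le_abs_self _).trans_lt (lt_of_le_of_lt ?_ hcM)
    rw [abs_mul, abs_neg_one_pow, one_mul, abs_mul]
    gcongr
    exact hM _ Chebyshev.node_mem_Icc
  have hqdeg : (Chebyshev.T ℝ (N : ℤ) - C c * p).natDegree ≤ N :=
    (natDegree_sub_le _ _).trans (max_le (by simp [Chebyshev.natDegree_T])
      ((natDegree_C_mul_le _ _).trans hdeg))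
  rcases coeff_ne_zero_or_of_card_roots hqdeg (le_card_roots_of_alternating halt) hmN with h | h
  · apply h
    rw [coeff_sub, coeff_C_mul, coeff_T_eq_zero (by omega), hpar m (by omega)]
    simp
  · apply h
    rw [coeff_sub, coeff_C_mul, hc, div_mul_cancel₀ _ (abs_pos.1 ha), sub_self]

theorem abs_coeff_le_markovNum {p : ℝ[X]} {d m : ℕ} {M : ℝ} (hdeg : p.natDegree ≤ d)
    (hM : ∀ t ∈ Set.Icc (-1 : ℝ) 1, |p.eval t| ≤ M) (hm : m ≠ 0) (hmd : m ≤ d) :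
    |p.coeff m| ≤ markovNum m d * M := by
  set q : ℝ[X] := C (1 / 2) * (p + C ((-1) ^ m) * p.comp (-X)) with hq
  have hcoeff : ∀ j, q.coeff j = 1 / 2 * (1 + (-1) ^ m * (-1) ^ j) * p.coeff j := by
    intro j
    rw [hq, coeff_C_mul, coeff_add, coeff_C_mul, coeff_comp_neg_X]
    ring
  have hqm : q.coeff m = p.coeff m := by
    rw [hcoeff, ← mul_pow]
    norm_num
  have hpar : ∀ j, j % 2 ≠ m % 2 → q.coeff j = 0 := by
    intro j hj
    rw [hcoeff, ← pow_add, Odd.neg_one_pow (by grind)]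
    simp
  have hqM : ∀ t ∈ Set.Icc (-1 : ℝ) 1, |q.eval t| ≤ M := by
    intro t ht
    have h1 := hM t ht
    have h2 : |(-1) ^ m * p.eval (-t)| ≤ M := by
      rw [abs_mul, abs_neg_one_pow, one_mul]
      exact hM (-t) ⟨by linarith [ht.2], by linarith [ht.1]⟩
    simp only [hq, eval_mul, eval_C, eval_add, eval_comp, eval_neg, eval_X]
    rw [abs_le] at *
    constructor <;> linarith
  have hqcoeff : ∀ j, d < j → q.coeff j = 0 := by
    intro j hj
    rw [hcoeff, coeff_eq_zero_of_natDegree_lt (hdeg.trans_lt hj), mul_zero]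
  rw [← hqm, markovNum]
  split_ifs with h
  · refine abs_coeff_le_of_parity (natDegree_le_iff_coeff_eq_zero.2 hqcoeff)
      (fun j hj => hpar j (by omega)) hqM hm hmd h
  · rw [show (d : ℤ) - 1 = ((d - 1 : ℕ) : ℤ) by omega]
    refine abs_coeff_le_of_parity (natDegree_le_iff_coeff_eq_zero.2 fun j hj => ?_)
      (fun j hj => hpar j (by omega)) hqM hm (by omega) (by omega)
    rcases (show d < j ∨ j = d by omega) with hj | rfl
    · exact hqcoeff j hj
    · exact hpar j (by omega)

theorem MultilinearMap.apply_add_smul_const {d : ℕ} {E : Type*} [AddCommGroup E] [Module ℝ E]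
    (L : MultilinearMap ℝ (fun _ : Fin d => E) ℝ) (a b : ℝ) (x y : E) :
    L (fun _ => a • x + b • y) = ∑ s : Finset (Fin d),
      a ^ #s * b ^ (d - #s) * L (s.piecewise (fun _ => x) (fun _ => y)) := by
  refine (L.map_add_univ (fun _ => a • x) (fun _ => b • y)).trans
    (Finset.sum_congr rfl fun s _ => ?_)
  have hsplit : s.piecewise (fun _ => a • x) (fun _ => b • y) = fun i =>
      (if i ∈ s then a else b) • s.piecewise (fun _ => x) (fun _ => y) i := by
    funext i
    by_cases hi : i ∈ s <;> simp [hi]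
  rw [hsplit, L.map_smul_univ, smul_eq_mul, Finset.prod_ite]
  simp [Finset.filter_not, Finset.card_univ_sdiff]

theorem MultilinearMap.apply_piecewise_eq_of_card_eq {d : ℕ} {E : Type*} [AddCommGroup E]
    [Module ℝ E] (L : MultilinearMap ℝ (fun _ : Fin d => E) ℝ)
    (hsymm : ∀ (σ : Equiv.Perm (Fin d)) (v : Fin d → E), L (v ∘ σ) = L v)
    {s t : Finset (Fin d)} (hst : #s = #t) (x y : E) :
    L (s.piecewise (fun _ => x) (fun _ => y)) = L (t.piecewise (fun _ => x) (fun _ => y)) := by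
  let e : {i // i ∈ s} ≃ {i // i ∈ t} := Finset.equivOfCardEq hst
  rw [← hsymm e.extendSubtype (t.piecewise (fun _ => x) (fun _ => y))]
  congr 1
  funext i
  by_cases hi : i ∈ s
  · simp [hi, e.extendSubtype_mem i hi]
  · simp [hi, e.extendSubtype_not_mem i hi]

theorem abs_eval_le_supOnBox {n : ℕ} (P : MvPolynomial (Fin n) ℝ) {x : Fin n → ℝ}
    (hx : ∀ i, x i ∈ Set.Icc (-1 : ℝ) 1) : |MvPolynomial.eval x P| ≤ supOnBox P := by
  refine le_csSup ?_ ⟨x, hx, rfl⟩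
  have hcomp : IsCompact (Set.univ.pi fun _ : Fin n => Set.Icc (-1 : ℝ) 1) :=
    isCompact_univ_pi fun _ => isCompact_Icc
  refine (hcomp.bddAbove_image (f := fun z => |MvPolynomial.eval z P|)
    (MvPolynomial.continuous_eval P).abs.continuousOn).mono ?_
  rintro _ ⟨z, hz, rfl⟩
  exact ⟨z, fun i _ => hz i, rfl⟩

/-- Polarization estimate: if `L` is the symmetric `d`-linear form associated to a
`d`-homogeneous real polynomial `P`, then for `1 ≤ k ≤ d` and `x, y ∈ [-1,1]^n`,
`|L(x,…,x,y,…,y)| ≤ M_{k,d} · d^d/(k^k (d-k)^{d-k}) · k!(d-k)!/d! · ‖P‖_{[-1,1]^n}`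
(`x` appearing `k` times and `y` appearing `d - k` times). -/
theorem polarization_homogeneous {n d : ℕ} (P : MvPolynomial (Fin n) ℝ)
    (hP : P.IsHomogeneous d)
    (L : MultilinearMap ℝ (fun _ : Fin d => (Fin n → ℝ)) ℝ)
    (hsymm : ∀ (σ : Equiv.Perm (Fin d)) (v : Fin d → (Fin n → ℝ)), L (v ∘ σ) = L v)
    (hdiag : ∀ x : Fin n → ℝ, L (fun _ => x) = MvPolynomial.eval x P)
    (k : ℕ) (hk₁ : 1 ≤ k) (hk₂ : k ≤ d)
    (x y : Fin n → ℝ) (hx : ∀ i, x i ∈ Set.Icc (-1 : ℝ) 1)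
    (hy : ∀ i, y i ∈ Set.Icc (-1 : ℝ) 1) :
    |L (fun i => if (i : ℕ) < k then x else y)|
      ≤ markovNum k d * ((d : ℝ) ^ d / ((k : ℝ) ^ k * ((d - k : ℕ) : ℝ) ^ (d - k)))
        * ((k.factorial : ℝ) * ((d - k).factorial : ℝ) / (d.factorial : ℝ))
        * supOnBox P := by
  have hd : (0 : ℝ) < d := by exact_mod_cast hk₁.trans hk₂
  have hk : (0 : ℝ) < k := by exact_mod_cast hk₁
  set A := L (fun i => if (i : ℕ) < k then x else y) with hA
  set l : ℝ := k / d with hl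
  set μ : ℝ := ((d - k : ℕ) : ℝ) / d with hμ
  have hl0 : 0 < l := div_pos hk hd
  have hμ0 : 0 ≤ μ := by positivity
  have hlμ : l + μ = 1 := by
    rw [hl, hμ, ← add_div, ← Nat.cast_add, Nat.add_sub_cancel' hk₂, div_self hd.ne']
  let g : ℝ[X] := ∑ s : Finset (Fin d), monomial #s
    (l ^ #s * μ ^ (d - #s) * L (s.piecewise (fun _ => x) (fun _ => y)))
  have hgdeg : g.natDegree ≤ d := natDegree_sum_le_of_forall_le _ _ fun s _ =>
    (natDegree_monomial_le _).trans (by simpa using s.card_le_univ)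
  have hgeval : ∀ t, g.eval t = MvPolynomial.eval ((t * l) • x + μ • y) P := by
    intro t
    rw [← hdiag, L.apply_add_smul_const, eval_finsetSum]
    refine Finset.sum_congr rfl fun s _ => ?_
    rw [eval_monomial, mul_pow]
    ring
  have hgM : ∀ t ∈ Set.Icc (-1 : ℝ) 1, |g.eval t| ≤ supOnBox P := by
    intro t ht
    rw [hgeval]
    refine abs_eval_le_supOnBox P fun i => ?_
    have hta := abs_le.2 ht
    rw [Set.mem_Icc, ← abs_le]
    have hxi := abs_le.2 (hx i)
    have hyi := abs_le.2 (hy i)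
    calc |((t * l) • x + μ • y) i| ≤ |t * l * x i| + |μ * y i| := abs_add_le _ _
      _ = |t| * l * |x i| + μ * |y i| := by
        rw [abs_mul, abs_mul, abs_mul, abs_of_pos hl0, abs_of_nonneg hμ0]
      _ ≤ 1 * l * 1 + μ * 1 := by gcongr
      _ = 1 := by linarith
  have hgcoeff : g.coeff k = d.choose k * (l ^ k * μ ^ (d - k) * A) := by
    have hcard : #{i : Fin d | (i : ℕ) < k} = k := by
      rw [Fin.card_filter_val_lt, min_eq_right hk₂]
    have hA' : A = L (({i : Fin d | (i : ℕ) < k} : Finset (Fin d)).piecewise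
        (fun _ => x) (fun _ => y)) := by
      rw [hA]
      congr 1
      funext i
      simp [Finset.piecewise]
    simp only [g, finsetSum_coeff, coeff_monomial]
    rw [← Finset.sum_filter, Finset.sum_congr rfl (g := fun _ => l ^ k * μ ^ (d - k) * A),
      Finset.sum_const, nsmul_eq_mul]
    · congr 2
      rw [Finset.univ_filter_card_eq, Finset.card_powersetCard, Finset.card_fin]
    · intro s hs
      have hs' : #s = k := by simpa using hs
      rw [hs', hA', L.apply_piecewise_eq_of_card_eq hsymm (hs'.trans hcard.symm)]
  have hmain := abs_coeff_le_markovNum hgdeg hgM (by omega) hk₂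
  have hpow : l ^ k * μ ^ (d - k) =
      ((k : ℝ) ^ k * ((d - k : ℕ) : ℝ) ^ (d - k)) / (d : ℝ) ^ d := by
    rw [hl, hμ, div_pow, div_pow, div_mul_div_comm, ← pow_add, Nat.add_sub_cancel' hk₂]
  have hkk : 0 < (k : ℝ) ^ k * ((d - k : ℕ) : ℝ) ^ (d - k) := by
    refine mul_pos (pow_pos hk _) ?_
    exact_mod_cast Nat.pow_self_pos
  have hW : 0 < (d.choose k : ℝ) * (l ^ k * μ ^ (d - k)) := by
    rw [hpow]
    have := Nat.choose_pos hk₂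
    positivity
  rw [hgcoeff, ← mul_assoc, abs_mul, abs_of_pos hW, mul_comm, ← le_div_iff₀ hW] at hmain
  refine hmain.trans_eq ?_
  rw [hpow, Nat.cast_choose ℝ hk₂]
  field_simp
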